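/- arXiv:1902.05902 — 2 statements merged into one kernel-verified Lean document; each statement's English description precedes it below -/
import Mathlib

section
/- The set of natural numbers inside the real numbers, Set.range ((↑) : ℕ → ℝ) = {x : ℝ | ∃ n : ℕ, x = n}, is not definable without parameters in the ring language over ℝ, i.e. ¬ Set.Definable (∅ : Set ℝ) FirstOrder.Language.ring (Set.range ((↑) : ℕ → ℝ)). -/
open FirstOrder Language

attribute [local instance] FirstOrder.Ring.compatibleRingOfRing

open SignType

theorem exists_orderIso_glue (h₁ h₂ : ℝ ≃o ℝ) (c : ℝ) (hc : h₁ c = h₂ c) :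
    ∃ h : ℝ ≃o ℝ, (∀ x ≤ c, h x = h₁ x) ∧ ∀ x, c ≤ x → h x = h₂ x := by
  let h : ℝ → ℝ := fun x => if x ≤ c then h₁ x else h₂ x
  have hle : ∀ x ≤ c, h x = h₁ x := fun x hx => if_pos hx
  have hge : ∀ x, c ≤ x → h x = h₂ x := by
    intro x hx
    rcases hx.eq_or_lt with rfl | hx
    · exact (hle _ le_rfl).trans hc
    · exact if_neg hx.not_ge
  have hmono : StrictMono h :=
    StrictMonoOn.Iic_union_Ici (a := c)
      (fun x hx y hy hxy => by rw [hle x hx, hle y hy]; exact h₁.strictMono hxy)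
      (fun x hx y hy hxy => by rw [hge x hx, hge y hy]; exact h₂.strictMono hxy)
  have hsurj : Function.Surjective h := by
    intro y
    rcases le_total y (h₁ c) with hy | hy
    · exact ⟨h₁.symm y, by rw [hle _ (h₁.symm_apply_le.2 hy), h₁.apply_symm_apply]⟩
    · exact ⟨h₂.symm y, by rw [hge _ (h₂.le_symm_apply.2 (hc ▸ hy)), h₂.apply_symm_apply]⟩
  exact ⟨hmono.orderIsoOfSurjective h hsurj, hle, hge⟩

theorem exists_orderIso_affine {a b c d : ℝ} (hab : a < b) (hcd : c < d) :
    ∃ h : ℝ ≃o ℝ, h a = c ∧ h b = d := by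
  have hk : 0 < (d - c) / (b - a) := div_pos (sub_pos.2 hcd) (sub_pos.2 hab)
  refine ⟨((OrderIso.addRight (-a)).trans (OrderIso.mulRight₀ _ hk)).trans (OrderIso.addRight c),
    ?_, ?_⟩
  · simp
  · have : b - a ≠ 0 := (sub_pos.2 hab).ne'
    simp [← sub_eq_add_neg]
    field_simp
    ring

/-- Any point of an open interval can be moved to any other one by an order automorphism of `ℝ`
supported in that interval. -/
theorem exists_orderIso_move {a b r s : ℝ} (har : a < r) (hrb : r < b) (has : a < s)
    (hsb : s < b) :
    ∃ h : ℝ ≃o ℝ, h r = s ∧ (∀ x ≤ a, h x = x) ∧ ∀ x, b ≤ x → h x = x := by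
  obtain ⟨h₁, h₁a, h₁r⟩ := exists_orderIso_affine har has
  obtain ⟨h₂, h₂r, h₂b⟩ := exists_orderIso_affine hrb hsb
  obtain ⟨k, hk, hk'⟩ := exists_orderIso_glue (OrderIso.refl ℝ) h₁ a h₁a.symm
  obtain ⟨l, hl, hl'⟩ := exists_orderIso_glue h₂ (OrderIso.refl ℝ) b h₂b
  obtain ⟨h, hh, hh'⟩ := exists_orderIso_glue k l r
    (by rw [hk' r har.le, hl r hrb.le, h₁r, h₂r])
  refine ⟨h, ?_, ?_, ?_⟩
  · rw [hh r le_rfl, hk' r har.le, h₁r]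
  · intro x hx
    rw [hh x (hx.trans har.le), hk x hx, OrderIso.refl_apply]
  · intro x hx
    rw [hh' x (hrb.le.trans hx), hl' x hx, OrderIso.refl_apply]

theorem exists_orderIso_sign_eq_of_strictMonoOn {P Q : ℝ → ℝ} {a b : ℝ} (hab : a < b)
    (hPc : Continuous P) (hQc : Continuous Q)
    (hP : StrictMonoOn P (Set.Icc a b)) (hQ : StrictMonoOn Q (Set.Icc a b))
    (ha : sign (P a) = sign (Q a)) (hb : sign (P b) = sign (Q b)) :
    ∃ h : ℝ ≃o ℝ, h a = a ∧ h b = b ∧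
      ∀ x ∈ Set.Ioo a b, sign (P x) = sign (Q (h x)) := by
  have haI : a ∈ Set.Icc a b := Set.left_mem_Icc.2 hab.le
  have hbI : b ∈ Set.Icc a b := Set.right_mem_Icc.2 hab.le
  rcases le_or_gt 0 (P a) with h0 | h0
  · have h0' : 0 ≤ Q a := by rwa [← sign_nonneg_iff, ← ha, sign_nonneg_iff]
    refine ⟨OrderIso.refl ℝ, rfl, rfl, fun x hx => ?_⟩
    rw [OrderIso.refl_apply, sign_pos (h0.trans_lt (hP haI (Set.Ioo_subset_Icc_self hx) hx.1)),
      sign_pos (h0'.trans_lt (hQ haI (Set.Ioo_subset_Icc_self hx) hx.1))]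
  rcases le_or_gt (P b) 0 with h1 | h1
  · have h1' : Q b ≤ 0 := by rwa [← sign_nonpos_iff, ← hb, sign_nonpos_iff]
    refine ⟨OrderIso.refl ℝ, rfl, rfl, fun x hx => ?_⟩
    rw [OrderIso.refl_apply, sign_neg ((hP (Set.Ioo_subset_Icc_self hx) hbI hx.2).trans_le h1),
      sign_neg ((hQ (Set.Ioo_subset_Icc_self hx) hbI hx.2).trans_le h1')]
  have h0' : Q a < 0 := by rwa [← sign_eq_neg_one_iff, ← ha, sign_eq_neg_one_iff]
  have h1' : 0 < Q b := by rwa [← sign_eq_one_iff, ← hb, sign_eq_one_iff]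
  obtain ⟨r, hr, hr0⟩ := intermediate_value_Ioo hab.le hPc.continuousOn ⟨h0, h1⟩
  obtain ⟨s, hs, hs0⟩ := intermediate_value_Ioo hab.le hQc.continuousOn ⟨h0', h1'⟩
  obtain ⟨h, hrs, hha, hhb⟩ := exists_orderIso_move hr.1 hr.2 hs.1 hs.2
  refine ⟨h, hha a le_rfl, hhb b le_rfl, fun x hx => ?_⟩
  have hhx : h x ∈ Set.Icc a b :=
    ⟨hha a le_rfl ▸ h.monotone hx.1.le, (h.monotone hx.2.le).trans_eq (hhb b le_rfl)⟩
  rcases lt_trichotomy x r with hxr | rfl | hxr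
  · rw [sign_neg (hr0 ▸ hP (Set.Ioo_subset_Icc_self hx) (Set.Ioo_subset_Icc_self hr) hxr),
      sign_neg (hs0 ▸ hQ hhx (Set.Ioo_subset_Icc_self hs) (hrs ▸ h.strictMono hxr))]
  · rw [hrs, hr0, hs0]
  · rw [sign_pos (hr0 ▸ hP (Set.Ioo_subset_Icc_self hr) (Set.Ioo_subset_Icc_self hx) hxr),
      sign_pos (hs0 ▸ hQ (Set.Ioo_subset_Icc_self hs) hhx (hrs ▸ h.strictMono hxr))]

/-- A point outside a closed set that is unbounded in both directions lies in a gap of it. -/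
theorem exists_mem_gap {Z : Set ℝ} (hZ : IsClosed Z) (hlo : ∀ x, ∃ z ∈ Z, z ≤ x)
    (hhi : ∀ x, ∃ z ∈ Z, x ≤ z) {x : ℝ} (hx : x ∉ Z) :
    ∃ a ∈ Z, ∃ b ∈ Z, x ∈ Set.Ioo a b ∧ Disjoint (Set.Ioo a b) Z := by
  have hA : IsGreatest (Z ∩ Set.Iic x) (sSup (Z ∩ Set.Iic x)) :=
    (hZ.inter isClosed_Iic).isGreatest_csSup (hlo x) ⟨x, fun _ h => h.2⟩
  have hB : IsLeast (Z ∩ Set.Ici x) (sInf (Z ∩ Set.Ici x)) :=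
    (hZ.inter isClosed_Ici).isLeast_csInf (hhi x) ⟨x, fun _ h => h.2⟩
  refine ⟨_, hA.1.1, _, hB.1.1, ⟨hA.1.2.lt_of_ne ?_, hB.1.2.lt_of_ne' ?_⟩, ?_⟩
  · intro h
    exact hx (h ▸ hA.1.1)
  · intro h
    exact hx (h ▸ hB.1.1)
  · rw [Set.disjoint_left]
    intro y hy hyZ
    rcases le_total y x with h | h
    · exact (hA.2 ⟨hyZ, h⟩).not_gt hy.1
    · exact (hB.2 ⟨hyZ, h⟩).not_gt hy.2

/-- Order automorphisms chosen on each gap of a closed set glue together. -/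
theorem exists_orderIso_of_gaps {Z : Set ℝ} (hZ : IsClosed Z) (hlo : ∀ x, ∃ z ∈ Z, z ≤ x)
    (hhi : ∀ x, ∃ z ∈ Z, x ≤ z) (R : ℝ → ℝ → Prop)
    (hR : ∀ a ∈ Z, ∀ b ∈ Z, a < b → Disjoint (Set.Ioo a b) Z →
      ∃ h : ℝ ≃o ℝ, h a = a ∧ h b = b ∧ ∀ x ∈ Set.Ioo a b, R x (h x)) :
    ∃ ψ : ℝ ≃o ℝ, (∀ z ∈ Z, ψ z = z) ∧ ∀ x ∉ Z, R x (ψ x) := by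
  choose! α hα β hβ hmem hdisj using fun x (hx : x ∉ Z) => exists_mem_gap hZ hlo hhi hx
  choose! h hha hhb hhR using hR
  classical
  let ψ : ℝ → ℝ := fun x => if x ∈ Z then x else h (α x) (β x) x
  have hψ : ∀ z ∈ Z, ψ z = z := fun z hz => if_pos hz
  have huniq : ∀ a ∈ Z, ∀ b ∈ Z, Disjoint (Set.Ioo a b) Z → ∀ x ∈ Set.Ioo a b,
      α x = a ∧ β x = b := by
    intro a ha b hb hd x hx
    have hxZ : x ∉ Z := Set.disjoint_left.1 hd hx
    have h1 := hmem x hxZ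
    have h2 := Set.disjoint_left.1 hd
    have h3 := Set.disjoint_left.1 (hdisj x hxZ)
    constructor
    · by_contra hne
      rcases lt_or_gt_of_ne hne with hl | hl
      · exact h3 ⟨hl, hx.1.trans h1.2⟩ ha
      · exact h2 ⟨hl, h1.1.trans hx.2⟩ (hα x hxZ)
    · by_contra hne
      rcases lt_or_gt_of_ne hne with hl | hl
      · exact h2 ⟨hx.1.trans h1.2, hl⟩ (hβ x hxZ)
      · exact h3 ⟨h1.1.trans hx.2, hl⟩ hb
  have hψgap : ∀ a ∈ Z, ∀ b ∈ Z, Disjoint (Set.Ioo a b) Z → ∀ x ∈ Set.Ioo a b,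
      ψ x = h a b x := by
    intro a ha b hb hd x hx
    have hxZ : x ∉ Z := Set.disjoint_left.1 hd hx
    obtain ⟨h1, h2⟩ := huniq a ha b hb hd x hx
    simp only [ψ, if_neg hxZ, h1, h2]
  have hmaps : ∀ x ∉ Z, ψ x ∈ Set.Ioo (α x) (β x) := by
    intro x hx
    have hlt := (hmem x hx).1.trans (hmem x hx).2
    rw [hψgap _ (hα x hx) _ (hβ x hx) (hdisj x hx) x (hmem x hx)]
    constructor
    · conv_lhs => rw [← hha _ (hα x hx) _ (hβ x hx) hlt (hdisj x hx)]
      exact (h _ _).strictMono (hmem x hx).1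
    · conv_rhs => rw [← hhb _ (hα x hx) _ (hβ x hx) hlt (hdisj x hx)]
      exact (h _ _).strictMono (hmem x hx).2
  have hltZ : ∀ x, ∀ z ∈ Z, x < z → ψ x < z := by
    intro x z hz hxz
    by_cases hx : x ∈ Z
    · rwa [hψ x hx]
    · refine (hmaps x hx).2.trans_le (not_lt.1 fun hlt => ?_)
      exact Set.disjoint_left.1 (hdisj x hx) ⟨(hmem x hx).1.trans hxz, hlt⟩ hz
  have hZlt : ∀ x, ∀ z ∈ Z, z < x → z < ψ x := by
    intro x z hz hxz
    by_cases hx : x ∈ Z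
    · rwa [hψ x hx]
    · refine (not_lt.1 fun hlt => ?_ : z ≤ α x).trans_lt (hmaps x hx).1
      exact Set.disjoint_left.1 (hdisj x hx) ⟨hlt, hxz.trans (hmem x hx).2⟩ hz
  have hmono : StrictMono ψ := by
    intro x y hxy
    by_cases hx : x ∈ Z
    · rw [hψ x hx]
      exact hZlt y x hx hxy
    rcases lt_or_ge y (β x) with hy | hy
    · have hyI : y ∈ Set.Ioo (α x) (β x) := ⟨(hmem x hx).1.trans hxy, hy⟩
      rw [hψgap _ (hα x hx) _ (hβ x hx) (hdisj x hx) x (hmem x hx),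
        hψgap _ (hα x hx) _ (hβ x hx) (hdisj x hx) y hyI]
      exact (h _ _).strictMono hxy
    · refine (hmaps x hx).2.trans_le ?_
      rcases hy.eq_or_lt with hy | hy
      · rw [← hy, hψ _ (hβ x hx)]
      · exact (hZlt y _ (hβ x hx) hy).le
  have hsurj : Function.Surjective ψ := by
    intro y
    by_cases hy : y ∈ Z
    · exact ⟨y, hψ y hy⟩
    have hlt := (hmem y hy).1.trans (hmem y hy).2
    refine ⟨(h (α y) (β y)).symm y, ?_⟩
    rw [hψgap _ (hα y hy) _ (hβ y hy) (hdisj y hy), OrderIso.apply_symm_apply]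
    constructor
    · rw [OrderIso.lt_symm_apply, hha _ (hα y hy) _ (hβ y hy) hlt (hdisj y hy)]
      exact (hmem y hy).1
    · rw [OrderIso.symm_apply_lt, hhb _ (hα y hy) _ (hβ y hy) hlt (hdisj y hy)]
      exact (hmem y hy).2
  refine ⟨hmono.orderIsoOfSurjective ψ hsurj, hψ, fun x hx => ?_⟩
  change R x (ψ x)
  rw [hψgap _ (hα x hx) _ (hβ x hx) (hdisj x hx) x (hmem x hx)]
  exact hhR _ (hα x hx) _ (hβ x hx) ((hmem x hx).1.trans (hmem x hx).2) (hdisj x hx) x (hmem x hx)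

theorem Asymptotics.IsEquivalent.eventually_sign_eq {α : Type*} {l : Filter α} {u v : α → ℝ}
    (h : Asymptotics.IsEquivalent l u v) : ∀ᶠ x in l, sign (u x) = sign (v x) := by
  obtain ⟨w, hw, huv⟩ := h.exists_eq_mul
  filter_upwards [huv, hw.eventually (lt_mem_nhds one_pos)] with x hx hwx
  rw [hx, Pi.mul_apply, sign_mul, sign_pos hwx, one_mul]

theorem Polynomial.eventually_sign_eval_atTop (P : Polynomial ℝ) :
    ∀ᶠ x in Filter.atTop, sign (P.eval x) = sign P.leadingCoeff := by
  filter_upwards [P.isEquivalent_atTop_lead.eventually_sign_eq, Filter.eventually_gt_atTop 0]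
    with x hx hx0
  rw [hx, sign_mul, sign_pow, sign_pos hx0, one_pow, mul_one]

theorem Polynomial.eventually_sign_eval_atBot (P : Polynomial ℝ) :
    ∀ᶠ x in Filter.atBot, sign (P.eval x) = sign P.leadingCoeff * (-1) ^ P.natDegree := by
  filter_upwards [P.isEquivalent_atBot_lead.eventually_sign_eq, Filter.eventually_lt_atBot 0]
    with x hx hx0
  rw [hx, sign_mul, sign_pow, sign_neg hx0]

theorem IsPreconnected.sign_eq_of_ne_zero {F : ℝ → ℝ} {s : Set ℝ} (hs : IsPreconnected s)
    (hF : Continuous F) (h0 : ∀ x ∈ s, F x ≠ 0) {x y : ℝ} (hx : x ∈ s) (hy : y ∈ s) :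
    sign (F x) = sign (F y) :=
  hs.constant (f := fun x => sign (F x))
    (fun z hz => ((continuousAt_sign_of_ne_zero (h0 z hz)).comp
      hF.continuousAt).continuousWithinAt) hx hy

theorem exists_orderIso_sign_eq_of_polynomial {P Q : Polynomial ℝ} {a b : ℝ} (hab : a < b)
    (φ : ℝ ≃o ℝ)
    (hder : ∀ x, sign (P.derivative.eval x) = sign (Q.derivative.eval (φ x)))
    (hne : ∀ x ∈ Set.Ioo a b, P.derivative.eval x ≠ 0)
    (ha : sign (P.eval a) = sign (Q.eval (φ a))) (hb : sign (P.eval b) = sign (Q.eval (φ b))) :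
    ∃ h : ℝ ≃o ℝ, h a = a ∧ h b = b ∧
      ∀ x ∈ Set.Ioo a b, sign (P.eval x) = sign (Q.eval (φ (h x))) := by
  wlog hpos : ∀ x ∈ Set.Ioo a b, 0 < P.derivative.eval x generalizing P Q
  · have hneg : ∀ x ∈ Set.Ioo a b, P.derivative.eval x < 0 := by
      push Not at hpos
      obtain ⟨y, hy, hy0⟩ := hpos
      intro x hx
      rw [← sign_eq_neg_one_iff, isPreconnected_Ioo.sign_eq_of_ne_zero
        P.derivative.continuous hne hx hy, sign_eq_neg_one_iff]
      exact hy0.lt_of_ne (hne y hy)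
    obtain ⟨h, h1, h2, h3⟩ := this (P := -P) (Q := -Q)
      (by simpa [Left.sign_neg] using hder) (by simpa using hne)
      (by simpa [Left.sign_neg] using ha) (by simpa [Left.sign_neg] using hb)
      (by simpa using hneg)
    exact ⟨h, h1, h2, by simpa [Left.sign_neg] using h3⟩
  refine exists_orderIso_sign_eq_of_strictMonoOn hab P.continuous
    (Q := fun x => Q.eval (φ x)) (Q.continuous.comp φ.continuous) ?_ ?_ ha hb
  · refine strictMonoOn_of_deriv_pos (convex_Icc a b) P.continuousOn fun x hx => ?_
    rw [interior_Icc] at hx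
    rw [Polynomial.deriv]
    exact hpos x hx
  · have hQ : StrictMonoOn (fun y => Q.eval y) (Set.Icc (φ a) (φ b)) := by
      refine strictMonoOn_of_deriv_pos (convex_Icc _ _) Q.continuousOn fun y hy => ?_
      rw [interior_Icc] at hy
      obtain ⟨x, rfl⟩ := φ.surjective y
      rw [Polynomial.deriv, ← sign_eq_one_iff, ← hder, sign_eq_one_iff]
      exact hpos x ⟨φ.lt_iff_lt.1 hy.1, φ.lt_iff_lt.1 hy.2⟩
    exact hQ.comp (φ.strictMono.strictMonoOn _)
      fun x hx => ⟨φ.monotone hx.1, φ.monotone hx.2⟩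

section Polynomial

open Polynomial

variable {A : Type*} [CommRing A]

/-- The first step in the pseudo-division of `p` by `q`. -/
noncomputable def pseudoRem (p q : Polynomial A) : Polynomial A :=
  C q.leadingCoeff * p.eraseLead -
    C p.leadingCoeff * X ^ (p.natDegree - q.natDegree) * q.eraseLead

theorem pseudoRem_eq {p q : Polynomial A} (h : q.natDegree ≤ p.natDegree) :
    pseudoRem p q = C q.leadingCoeff * p - C p.leadingCoeff *
      X ^ (p.natDegree - q.natDegree) * q := by
  have hp := p.eraseLead_add_C_mul_X_pow
  have hq := q.eraseLead_add_C_mul_X_pow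
  have hX : (X : Polynomial A) ^ (p.natDegree - q.natDegree) * X ^ q.natDegree =
      X ^ p.natDegree := by
    rw [← pow_add, Nat.sub_add_cancel h]
  rw [pseudoRem]
  linear_combination C q.leadingCoeff * hp - C p.leadingCoeff *
    X ^ (p.natDegree - q.natDegree) * hq + C p.leadingCoeff * C q.leadingCoeff * hX

theorem natDegree_pseudoRem_lt {p q : Polynomial A} (h : q.natDegree ≤ p.natDegree)
    (hq : 0 < q.natDegree) : (pseudoRem p q).natDegree < p.natDegree := by
  have hp' := p.eraseLead_natDegree_le
  have hq' := q.eraseLead_natDegree_le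
  refine (natDegree_sub_le _ _).trans_lt (max_lt ?_ ?_)
  · exact (natDegree_C_mul_le _ _).trans_lt (by omega)
  · refine natDegree_mul_le.trans_lt ?_
    have := natDegree_C_mul_X_pow_le p.leadingCoeff (p.natDegree - q.natDegree)
    omega

/-- The analogue of `pseudoRem` for the division of `p` by its derivative. -/
noncomputable def derivRem (p : Polynomial A) : Polynomial A :=
  C (p.natDegree : A) * p.eraseLead - X * derivative p.eraseLead

theorem derivRem_eq (p : Polynomial A) :
    derivRem p = C (p.natDegree : A) * p - X * derivative p := by
  have hp := p.eraseLead_add_C_mul_X_pow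
  have hd := congrArg derivative hp
  rw [derivRem]
  generalize p.natDegree = d at hp hd ⊢
  rcases d with _ | d
  · simp only [derivative_add, pow_zero, mul_one, derivative_C, add_zero] at hd
    simp [hd]
  · simp only [derivative_add, derivative_C_mul_X_pow, map_mul, Nat.add_sub_cancel] at hd
    linear_combination C ((d + 1 : ℕ) : A) * hp - X * hd

theorem natDegree_derivRem_lt {p : Polynomial A} (h : 0 < p.natDegree) :
    (derivRem p).natDegree < p.natDegree := by
  have hp := p.eraseLead_natDegree_le
  refine (natDegree_sub_le _ _).trans_lt (max_lt ?_ ?_)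
  · exact (natDegree_C_mul_le _ _).trans_lt (by omega)
  · by_cases h0 : p.eraseLead.natDegree = 0
    · rw [derivative_of_natDegree_zero h0]
      simpa using h
    · refine natDegree_mul_le.trans_lt ?_
      have := natDegree_derivative_lt h0
      have := natDegree_X_le (R := A)
      omega

/-- The signs of the specializations of `p` along `f` and `g` correspond to each other
under `φ`. -/
def SignMatch (f g : A →+* ℝ) (φ : ℝ ≃o ℝ) (p : Polynomial A) : Prop :=
  ∀ x, sign (p.eval₂ f x) = sign (p.eval₂ g (φ x))

variable {f g : A →+* ℝ} {φ : ℝ ≃o ℝ} {p q : Polynomial A}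

theorem SignMatch.eval₂_eq_zero (h : SignMatch f g φ p) {x : ℝ} (hx : p.eval₂ f x = 0) :
    p.eval₂ g (φ x) = 0 := by
  rw [← sign_eq_zero_iff, ← h, hx, sign_zero]

theorem sign_eval₂_eq_of_pseudoRem (hdeg : q.natDegree ≤ p.natDegree)
    (hlc : f q.leadingCoeff ≠ 0) (hsign : sign (f q.leadingCoeff) = sign (g q.leadingCoeff))
    (hq : SignMatch f g φ q) (hr : SignMatch f g φ (pseudoRem p q)) {x : ℝ}
    (hx : q.eval₂ f x = 0) : sign (p.eval₂ f x) = sign (p.eval₂ g (φ x)) := by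
  have h := hr x
  rw [pseudoRem_eq hdeg] at h
  simp only [eval₂_sub, eval₂_mul, eval₂_C, hx, hq.eval₂_eq_zero hx, mul_zero, sub_zero,
    sign_mul, ← hsign] at h
  exact mul_left_cancel₀ (sign_ne_zero.2 hlc) h

theorem sign_eval₂_eq_of_derivRem (hdeg : 0 < p.natDegree)
    (hd : SignMatch f g φ (derivative p)) (hr : SignMatch f g φ (derivRem p)) {x : ℝ}
    (hx : (derivative p).eval₂ f x = 0) : sign (p.eval₂ f x) = sign (p.eval₂ g (φ x)) := by
  have h := hr x
  rw [derivRem_eq] at h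
  simp only [eval₂_sub, eval₂_mul, eval₂_C, hx, hd.eval₂_eq_zero hx, mul_zero, sub_zero,
    sign_mul] at h
  rw [map_natCast f, map_natCast g, sign_pos (Nat.cast_pos.2 hdeg), one_mul, one_mul] at h
  exact h

theorem exists_signMatch_cons {R : Multiset (Polynomial A)} (hdeg : 0 < p.natDegree)
    (hlc : f p.leadingCoeff ≠ 0) (hsign : sign (f p.leadingCoeff) = sign (g p.leadingCoeff))
    (hR : ∀ q ∈ R, 0 < q.natDegree → q.natDegree ≤ p.natDegree ∧ f q.leadingCoeff ≠ 0 ∧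
      sign (f q.leadingCoeff) = sign (g q.leadingCoeff) ∧ SignMatch f g φ (pseudoRem p q))
    (hφ : ∀ q ∈ R, SignMatch f g φ q) (hd : SignMatch f g φ (derivative p))
    (hr : SignMatch f g φ (derivRem p)) :
    ∃ φ' : ℝ ≃o ℝ, ∀ q ∈ p ::ₘ R, SignMatch f g φ' q := by
  classical
  have hlc' : g p.leadingCoeff ≠ 0 := by rwa [← sign_ne_zero, ← hsign, sign_ne_zero]
  have hcont : ∀ q : Polynomial A, Continuous fun x => q.eval₂ f x := by
    intro q
    simp only [← eval_map]
    exact (q.map f).continuous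
  have hdm : ∀ (k : A →+* ℝ) (x : ℝ),
      (derivative (p.map k)).eval x = (derivative p).eval₂ k x := by
    intro k x
    rw [derivative_map, eval_map]
  have hhi : ∀ᶠ z in Filter.atTop, sign (p.eval₂ f z) = sign (p.eval₂ g (φ z)) := by
    filter_upwards [(p.map f).eventually_sign_eval_atTop,
      φ.tendsto_atTop.eventually (p.map g).eventually_sign_eval_atTop] with z h1 h2
    rw [← eval_map, ← eval_map, h1, h2, leadingCoeff_map_of_leadingCoeff_ne_zero f hlc,
      leadingCoeff_map_of_leadingCoeff_ne_zero g hlc', hsign]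
  have hlo : ∀ᶠ z in Filter.atBot, sign (p.eval₂ f z) = sign (p.eval₂ g (φ z)) := by
    filter_upwards [(p.map f).eventually_sign_eval_atBot,
      φ.tendsto_atBot.eventually (p.map g).eventually_sign_eval_atBot] with z h1 h2
    rw [← eval_map, ← eval_map, h1, h2, leadingCoeff_map_of_leadingCoeff_ne_zero f hlc,
      leadingCoeff_map_of_leadingCoeff_ne_zero g hlc', hsign,
      natDegree_map_of_leadingCoeff_ne_zero f hlc, natDegree_map_of_leadingCoeff_ne_zero g hlc']
  obtain ⟨M, hM⟩ := Filter.eventually_atTop.1 hhi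
  obtain ⟨m, hm⟩ := Filter.eventually_atBot.1 hlo
  let Z : Set ℝ := (Set.Ici M ∪ Set.Iic m) ∪
    ({z | (derivative p).eval₂ f z = 0} ∪
      ⋃ q ∈ R.toFinset.filter (fun q => 0 < q.natDegree), {z | q.eval₂ f z = 0})
  have hZ : IsClosed Z := by
    refine (isClosed_Ici.union isClosed_Iic).union
      ((isClosed_eq (hcont _) continuous_const).union ?_)
    exact isClosed_biUnion_finset fun q _ => isClosed_eq (hcont _) continuous_const
  have hsZ : ∀ z ∈ Z, sign (p.eval₂ f z) = sign (p.eval₂ g (φ z)) := by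
    rintro z ((hz | hz) | (hz | hz))
    · exact hM z hz
    · exact hm z hz
    · exact sign_eval₂_eq_of_derivRem hdeg hd hr hz
    · simp only [Set.mem_iUnion, Finset.mem_filter, Multiset.mem_toFinset] at hz
      obtain ⟨q, ⟨hqR, hq0⟩, hz⟩ := hz
      obtain ⟨h1, h2, h3, h4⟩ := hR q hqR hq0
      exact sign_eval₂_eq_of_pseudoRem h1 h2 h3 (hφ q hqR) h4 hz
  obtain ⟨ψ, hψZ, hψ⟩ := exists_orderIso_of_gaps hZ
    (fun x => ⟨min m x, Or.inl (Or.inr (Set.mem_Iic.2 (min_le_left _ _))), min_le_right _ _⟩)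
    (fun x => ⟨max M x, Or.inl (Or.inl (Set.mem_Ici.2 (le_max_left _ _))), le_max_right _ _⟩)
    (fun x y => sign (p.eval₂ f x) = sign (p.eval₂ g (φ y)) ∧
      ∀ q ∈ R, sign (q.eval₂ f x) = sign (q.eval₂ f y)) (by
    intro a ha b hb hab hdisj
    obtain ⟨h, hha, hhb, hh⟩ := exists_orderIso_sign_eq_of_polynomial
      (P := p.map f) (Q := p.map g) hab φ
      (fun x => by rw [hdm, hdm]; exact hd x)
      (fun x hx h0 => Set.disjoint_left.1 hdisj hx (Or.inr (Or.inl (by rwa [hdm] at h0))))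
      (by rw [eval_map, eval_map]; exact hsZ a ha) (by rw [eval_map, eval_map]; exact hsZ b hb)
    refine ⟨h, hha, hhb, fun x hx => ⟨by simpa only [eval_map] using hh x hx, fun q hq => ?_⟩⟩
    rcases Nat.eq_zero_or_pos q.natDegree with h0 | h0
    · rw [eq_C_of_natDegree_eq_zero h0, eval₂_C, eval₂_C]
    · refine isPreconnected_Ioo.sign_eq_of_ne_zero (hcont q) (fun z hz hz0 => ?_) hx
        ⟨hha.symm.trans_lt (h.strictMono hx.1), (h.strictMono hx.2).trans_eq hhb⟩
      refine Set.disjoint_left.1 hdisj hz (Or.inr (Or.inr ?_))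
      simp only [Set.mem_iUnion, Finset.mem_filter, Multiset.mem_toFinset]
      exact ⟨q, ⟨hq, h0⟩, hz0⟩)
  refine ⟨ψ.trans φ, fun q hq x => ?_⟩
  rw [OrderIso.trans_apply]
  by_cases hx : x ∈ Z
  · rw [hψZ x hx]
    rcases Multiset.mem_cons.1 hq with rfl | hq
    · exact hsZ x hx
    · exact hφ q hq x
  · rcases Multiset.mem_cons.1 hq with rfl | hq
    · exact (hψ x hx).1
    · rw [(hψ x hx).2 q hq, hφ q hq]

theorem isDershowitzMannaLT_natDegree {R N : Multiset (Polynomial A)}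
    (hN : ∀ q ∈ N, q.natDegree < p.natDegree) :
    Multiset.IsDershowitzMannaLT ((R + N).map natDegree) ((p ::ₘ R).map natDegree) := by
  refine ⟨R.map natDegree, N.map natDegree, {p.natDegree}, by simp, by simp, ?_, ?_⟩
  · rw [Multiset.map_cons, ← Multiset.singleton_add, add_comm]
  · intro y hy
    obtain ⟨q, hq, rfl⟩ := Multiset.mem_map.1 hy
    exact ⟨_, Multiset.mem_singleton_self _, hN q hq⟩

/-- The arrangement of the real roots and the signs of finitely many specialized polynomials is
determined by the signs of finitely many elements of the coefficient ring. -/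
theorem exists_finset_forall_signMatch (S : Multiset (Polynomial A)) :
    ∃ T : Finset A, ∀ f g : A →+* ℝ, (∀ a ∈ T, sign (f a) = sign (g a)) →
      ∃ φ : ℝ ≃o ℝ, ∀ p ∈ S, SignMatch f g φ p := by
  classical
  induction S using (InvImage.wf (fun S : Multiset (Polynomial A) => S.map natDegree)
    Multiset.wellFounded_isDershowitzMannaLT).induction with
  | _ S ih =>
  by_cases hconst : ∀ p ∈ S, p.natDegree = 0
  · refine ⟨S.toFinset.image fun p => p.coeff 0, fun f g h => ⟨OrderIso.refl ℝ, ?_⟩⟩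
    intro p hp x
    rw [eq_C_of_natDegree_eq_zero (hconst p hp), eval₂_C, eval₂_C]
    exact h _ (Finset.mem_image_of_mem _ (Multiset.mem_toFinset.2 hp))
  have hmax : ∃ p ∈ S, ∀ q ∈ S, q.natDegree ≤ p.natDegree := by
    push Not at hconst
    obtain ⟨p, hp, -⟩ := hconst
    simpa using S.toFinset.exists_max_image natDegree ⟨p, Multiset.mem_toFinset.2 hp⟩
  obtain ⟨p, hp, hmax⟩ := hmax
  have hp0 : 0 < p.natDegree := by
    push Not at hconst
    obtain ⟨q, hq, hq0⟩ := hconst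
    exact (Nat.pos_of_ne_zero hq0).trans_le (hmax q hq)
  have herase : ∀ q, ∃ T : Finset A, q ∈ S → 0 < q.natDegree → ∀ f g : A →+* ℝ,
      (∀ a ∈ T, sign (f a) = sign (g a)) →
      ∃ φ : ℝ ≃o ℝ, ∀ r ∈ S.erase q + {q.eraseLead}, SignMatch f g φ r := by
    intro q
    by_cases hq : q ∈ S ∧ 0 < q.natDegree
    · have hlt := isDershowitzMannaLT_natDegree (p := q) (R := S.erase q) (N := {q.eraseLead}) (by
        intro r hr
        rw [Multiset.mem_singleton.1 hr]
        have := q.eraseLead_natDegree_le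
        omega)
      rw [Multiset.cons_erase hq.1] at hlt
      obtain ⟨T, hT⟩ := ih _ hlt
      exact ⟨T, fun _ _ => hT⟩
    · exact ⟨∅, fun h1 h2 => absurd ⟨h1, h2⟩ hq⟩
  choose T hT using herase
  obtain ⟨T', hT'⟩ : ∃ T' : Finset A, ∀ f g : A →+* ℝ, (∀ a ∈ T', sign (f a) = sign (g a)) →
      ∃ φ : ℝ ≃o ℝ, ∀ r ∈ S.erase p + (derivative p ::ₘ derivRem p ::ₘ
        ((S.erase p).filter fun q => 0 < q.natDegree).map (pseudoRem p)),
        SignMatch f g φ r := by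
    refine ih _ ?_
    have hlt := isDershowitzMannaLT_natDegree (p := p) (R := S.erase p) (N := derivative p ::ₘ
        derivRem p ::ₘ ((S.erase p).filter fun q => 0 < q.natDegree).map (pseudoRem p)) (by
      intro r hr
      simp only [Multiset.mem_cons, Multiset.mem_map, Multiset.mem_filter] at hr
      rcases hr with rfl | rfl | ⟨q, ⟨hq, hq0⟩, rfl⟩
      · exact natDegree_derivative_lt hp0.ne'
      · exact natDegree_derivRem_lt hp0
      · exact natDegree_pseudoRem_lt (hmax q (Multiset.mem_of_mem_erase hq)) hq0)
    rwa [Multiset.cons_erase hp] at hlt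
  refine ⟨S.toFinset.image leadingCoeff ∪ S.toFinset.biUnion T ∪ T', fun f g h => ?_⟩
  have hlead : ∀ q ∈ S, sign (f q.leadingCoeff) = sign (g q.leadingCoeff) := fun q hq =>
    h _ (Finset.mem_union_left _ (Finset.mem_union_left _
      (Finset.mem_image_of_mem _ (Multiset.mem_toFinset.2 hq))))
  by_cases hvan : ∃ q ∈ S, 0 < q.natDegree ∧ f q.leadingCoeff = 0
  · obtain ⟨q, hq, hq0, hfq⟩ := hvan
    have hgq : g q.leadingCoeff = 0 := by
      rw [← sign_eq_zero_iff, ← hlead q hq, hfq, sign_zero]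
    obtain ⟨φ, hφ⟩ := hT q hq hq0 f g fun a ha => h a (Finset.mem_union_left _
      (Finset.mem_union_right _ (Finset.mem_biUnion.2 ⟨q, Multiset.mem_toFinset.2 hq, ha⟩)))
    refine ⟨φ, fun r hr => ?_⟩
    by_cases hrq : r = q
    · subst hrq
      intro x
      have heval : ∀ (k : A →+* ℝ) (y : ℝ), k r.leadingCoeff = 0 →
          r.eval₂ k y = r.eraseLead.eval₂ k y := by
        intro k y hk
        conv_lhs => rw [← r.eraseLead_add_C_mul_X_pow]
        rw [eval₂_add, eval₂_mul, eval₂_C, hk, zero_mul, add_zero]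
      rw [heval f x hfq, heval g (φ x) hgq]
      exact hφ r.eraseLead (by simp) x
    · exact hφ r (Multiset.mem_add.2 (Or.inl ((Multiset.mem_erase_of_ne hrq).2 hr)))
  · push Not at hvan
    obtain ⟨φ, hφ⟩ := hT' f g fun a ha => h a (Finset.mem_union_right _ ha)
    rw [← Multiset.cons_erase hp]
    refine exists_signMatch_cons (φ := φ) hp0 (hvan p hp hp0) (hlead p hp) ?_ ?_ ?_ ?_
    · intro q hq hq0
      have hqS := Multiset.mem_of_mem_erase hq
      refine ⟨hmax q hqS, hvan q hqS hq0, hlead q hqS, hφ _ ?_⟩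
      simp only [Multiset.mem_add, Multiset.mem_cons, Multiset.mem_map, Multiset.mem_filter]
      exact Or.inr (Or.inr (Or.inr ⟨q, ⟨hq, hq0⟩, rfl⟩))
    · exact fun q hq => hφ q (Multiset.mem_add.2 (Or.inl hq))
    · exact hφ _ (by simp)
    · exact hφ _ (by simp)

end Polynomial

theorem exists_mvPolynomial_realize_eq {β : Type*} (t : Language.ring.Term β) :
    ∃ p : MvPolynomial β ℤ, ∀ v : β → ℝ, t.realize v = MvPolynomial.aeval v p := by
  induction t with
  | var i => exact ⟨MvPolynomial.X i, fun v => by simp⟩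
  | func F ts ih =>
    choose p hp using ih
    cases F with
    | add => exact ⟨p 0 + p 1, fun v => by
        rw [map_add, ← hp, ← hp]; exact FirstOrder.Ring.CompatibleRing.funMap_add _⟩
    | mul => exact ⟨p 0 * p 1, fun v => by
        rw [map_mul, ← hp, ← hp]; exact FirstOrder.Ring.CompatibleRing.funMap_mul _⟩
    | neg => exact ⟨-p 0, fun v => by
        rw [map_neg, ← hp]; exact FirstOrder.Ring.CompatibleRing.funMap_neg _⟩
    | zero => exact ⟨0, fun v => by
        rw [map_zero]; exact FirstOrder.Ring.CompatibleRing.funMap_zero _⟩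
    | one => exact ⟨1, fun v => by
        rw [map_one]; exact FirstOrder.Ring.CompatibleRing.funMap_one _⟩

/-- View the last bound variable as the indeterminate of a univariate polynomial. -/
noncomputable def lastVarPolynomial {α : Type*} {n : ℕ} :
    MvPolynomial (α ⊕ Fin (n + 1)) ℤ →ₐ[ℤ] Polynomial (MvPolynomial (α ⊕ Fin n) ℤ) :=
  MvPolynomial.aeval (Sum.elim (fun a => Polynomial.C (MvPolynomial.X (Sum.inl a)))
    (Fin.snoc (fun i => Polynomial.C (MvPolynomial.X (Sum.inr i))) Polynomial.X))

theorem eval₂_lastVarPolynomial {α : Type*} {n : ℕ} (v : α → ℝ) (xs : Fin n → ℝ) (x : ℝ)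
    (p : MvPolynomial (α ⊕ Fin (n + 1)) ℤ) :
    (lastVarPolynomial p).eval₂ (MvPolynomial.aeval (R := ℤ) (Sum.elim v xs) :
        MvPolynomial (α ⊕ Fin n) ℤ →ₐ[ℤ] ℝ).toRingHom x =
      MvPolynomial.aeval (Sum.elim v (Fin.snoc xs x : Fin (n + 1) → ℝ)) p := by
  induction p using MvPolynomial.induction_on with
  | C a =>
    rw [lastVarPolynomial, MvPolynomial.aeval_C, MvPolynomial.aeval_C, eq_intCast, eq_intCast,
      ← Polynomial.coe_eval₂RingHom, map_intCast]
  | add p q hp hq => rw [map_add, map_add, Polynomial.eval₂_add, hp, hq]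
  | mul_X p i hp =>
    rw [map_mul, map_mul, Polynomial.eval₂_mul, hp]
    congr 1
    rcases i with a | i
    · simp [lastVarPolynomial]
    · refine Fin.lastCases ?_ (fun i => ?_) i <;> simp [lastVarPolynomial]

/-- The truth value of a formula is determined by the signs of finitely many polynomials. -/
theorem exists_finset_realize_iff {α : Type*} {n : ℕ} (φ : Language.ring.BoundedFormula α n) :
    ∃ T : Finset (MvPolynomial (α ⊕ Fin n) ℤ), ∀ (v w : α → ℝ) (xs ys : Fin n → ℝ),
      (∀ t ∈ T, sign (MvPolynomial.aeval (Sum.elim v xs) t) =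
        sign (MvPolynomial.aeval (Sum.elim w ys) t)) →
      (φ.Realize v xs ↔ φ.Realize w ys) := by
  classical
  induction φ with
  | falsum => exact ⟨∅, fun _ _ _ _ _ => Iff.rfl⟩
  | equal t₁ t₂ =>
    obtain ⟨p, hp⟩ := exists_mvPolynomial_realize_eq t₁
    obtain ⟨q, hq⟩ := exists_mvPolynomial_realize_eq t₂
    refine ⟨{p - q}, fun v w xs ys h => ?_⟩
    have h := h _ (Finset.mem_singleton_self _)
    simp only [BoundedFormula.Realize, hp, hq]
    rw [← sub_eq_zero, ← map_sub, ← sign_eq_zero_iff, h, sign_eq_zero_iff, map_sub, sub_eq_zero]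
  | rel r => exact r.elim
  | imp φ ψ ihφ ihψ =>
    obtain ⟨T, hT⟩ := ihφ
    obtain ⟨U, hU⟩ := ihψ
    refine ⟨T ∪ U, fun v w xs ys h => ?_⟩
    rw [BoundedFormula.realize_imp, BoundedFormula.realize_imp,
      hT v w xs ys fun t ht => h t (Finset.mem_union_left _ ht),
      hU v w xs ys fun t ht => h t (Finset.mem_union_right _ ht)]
  | all φ ih =>
    obtain ⟨T, hT⟩ := ih
    obtain ⟨U, hU⟩ := exists_finset_forall_signMatch (T.val.map lastVarPolynomial)
    refine ⟨U, fun v w xs ys h => ?_⟩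
    obtain ⟨θ, hθ⟩ := hU (MvPolynomial.aeval (R := ℤ) (Sum.elim v xs)).toRingHom
      (MvPolynomial.aeval (R := ℤ) (Sum.elim w ys)).toRingHom h
    have key : ∀ x, φ.Realize v (Fin.snoc xs x) ↔ φ.Realize w (Fin.snoc ys (θ x)) := by
      refine fun x => hT _ _ _ _ fun t ht => ?_
      rw [← eval₂_lastVarPolynomial, ← eval₂_lastVarPolynomial]
      exact hθ _ (Multiset.mem_map_of_mem _ ht) x
    rw [BoundedFormula.realize_all, BoundedFormula.realize_all]
    exact (forall_congr' key).trans
      (θ.surjective.forall (p := fun y => φ.Realize w (Fin.snoc ys y))).symm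

/-- A subset of `ℝ` definable in the language of rings eventually contains all points or none. -/
theorem Set.Definable₁.eventually_mem_iff {s : Set ℝ}
    (hs : Set.Definable₁ (∅ : Set ℝ) Language.ring s) :
    ∃ M, ∀ x y, M ≤ x → M ≤ y → (x ∈ s ↔ y ∈ s) := by
  obtain ⟨φ, hφ⟩ := Set.empty_definable_iff.1 hs
  have hmem : ∀ x, x ∈ s ↔ BoundedFormula.Realize φ (fun _ : Fin 1 => x) ![] := by
    intro x
    have h : (fun _ : Fin 1 => x) ∈ {x : Fin 1 → ℝ | x 0 ∈ s} ↔ _ := Set.ext_iff.1 hφ _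
    rwa [Set.mem_ofPred_eq, Set.mem_ofPred_eq, Formula.Realize,
      Unique.default_eq (![] : Fin 0 → ℝ)] at h
  obtain ⟨T, hT⟩ := exists_finset_realize_iff φ
  have haeval : ∀ (t : MvPolynomial (Fin 1 ⊕ Fin 0) ℤ) (x : ℝ),
      MvPolynomial.aeval (Sum.elim (fun _ => x) ![]) t =
        (MvPolynomial.aeval (fun _ => (Polynomial.X : Polynomial ℝ)) t).eval x := by
    intro t x
    induction t using MvPolynomial.induction_on with
    | C a => simp
    | add p q hp hq => rw [map_add, map_add, Polynomial.eval_add, hp, hq]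
    | mul_X p i hp =>
      rw [map_mul, map_mul, Polynomial.eval_mul, hp]
      rcases i with i | i
      · simp
      · exact i.elim0
  have hev : ∀ᶠ x : ℝ in Filter.atTop, ∀ t ∈ T,
      sign (MvPolynomial.aeval (Sum.elim (fun _ : Fin 1 => x) (![] : Fin 0 → ℝ)) t) =
        sign (MvPolynomial.aeval (fun _ => (Polynomial.X : Polynomial ℝ)) t).leadingCoeff := by
    rw [Filter.eventually_all_finset]
    intro t _
    simp only [haeval]
    exact Polynomial.eventually_sign_eval_atTop _
  obtain ⟨M, hM⟩ := Filter.eventually_atTop.1 hev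
  refine ⟨M, fun x y hx hy => ?_⟩
  rw [hmem, hmem]
  exact hT _ _ _ _ fun t ht => (hM x hx t ht).trans (hM y hy t ht).symm

/-- The set of natural numbers inside the real numbers is not definable without
parameters in the language of rings over `ℝ`. -/
theorem stmt_7 :
    ¬ Set.Definable₁ (∅ : Set ℝ) Language.ring (Set.range ((↑) : ℕ → ℝ)) := by
  intro h
  obtain ⟨M, hM⟩ := h.eventually_mem_iff
  obtain ⟨n, hn⟩ := exists_nat_ge M
  obtain ⟨m, hm⟩ := (hM n (n + 1 / 2) hn (by linarith)).1 ⟨n, rfl⟩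
  have hlt : n < m := by exact_mod_cast (by linarith : (n : ℝ) < m)
  have hlt' : m < n + 1 := by exact_mod_cast (by linarith : (m : ℝ) < n + 1)
  omega
end

section
/- The set of natural numbers inside the rationals, Set.range ((↑) : ℕ → ℚ) = {q : ℚ | ∃ n : ℕ, q = n}, is definable without parameters in the ring language over ℚ, i.e. Set.Definable (∅ : Set ℚ) FirstOrder.Language.ring (Set.range ((↑) : ℕ → ℚ)). -/
open FirstOrder Language
open scoped NumberTheorySymbols

attribute [local instance] FirstOrder.Ring.compatibleRingOfRing

/-- The lattice point count behind Legendre's theorem: given linear congruences modulo `a`, `b`, `c`,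
a small nonzero vector satisfies all of them. -/
theorem exists_small_solution_of_congruences {a b c : ℕ} (ha : 0 < a) (hb : 0 < b) (hc : 0 < c)
    (s t u : ℤ) :
    ∃ x y z : ℤ, (x ≠ 0 ∨ y ≠ 0 ∨ z ≠ 0) ∧ x ^ 2 ≤ b * c ∧ y ^ 2 ≤ a * c ∧ z ^ 2 ≤ a * b ∧
      (a : ℤ) ∣ b * y - s * z ∧ (b : ℤ) ∣ a * x - t * z ∧ (c : ℤ) ∣ a * x - u * y := by
  classical
  have : NeZero a := ⟨ha.ne'⟩
  have : NeZero b := ⟨hb.ne'⟩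
  have : NeZero c := ⟨hc.ne'⟩
  let B : Finset (ℕ × ℕ × ℕ) := Finset.range ((b * c).sqrt + 1) ×ˢ
    Finset.range ((a * c).sqrt + 1) ×ˢ Finset.range ((a * b).sqrt + 1)
  let f : ℕ × ℕ × ℕ → ZMod a × ZMod b × ZMod c := fun v ↦
    (((b * v.2.1 - s * v.2.2 : ℤ) : ZMod a), ((a * v.1 - t * v.2.2 : ℤ) : ZMod b),
      ((a * v.1 - u * v.2.1 : ℤ) : ZMod c))
  have hcard : (Finset.univ : Finset (ZMod a × ZMod b × ZMod c)).card < B.card := by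
    simp only [Finset.card_univ, Fintype.card_prod, ZMod.card, B, Finset.card_product,
      Finset.card_range]
    have h1 := Nat.lt_succ_sqrt' (b * c)
    have h2 := Nat.lt_succ_sqrt' (a * c)
    have h3 := Nat.lt_succ_sqrt' (a * b)
    simp only [Nat.succ_eq_add_one] at h1 h2 h3
    refine lt_of_pow_lt_pow_left₀ 2 (Nat.zero_le _) ?_
    calc (a * (b * c)) ^ 2 = (b * c) * ((a * c) * (a * b)) := by ring
      _ < ((b * c).sqrt + 1) ^ 2 * (((a * c).sqrt + 1) ^ 2 * ((a * b).sqrt + 1) ^ 2) := by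
        gcongr
      _ = _ := by ring
  obtain ⟨v, hv, w, hw, hvw, hf⟩ := Finset.exists_ne_map_eq_of_card_lt_of_maps_to hcard
    (f := f) (fun _ _ ↦ Finset.mem_univ _)
  obtain ⟨x, y, z⟩ := v
  obtain ⟨x', y', z'⟩ := w
  have bound : ∀ {n i j : ℕ}, i < n.sqrt + 1 → j < n.sqrt + 1 → ((i : ℤ) - j) ^ 2 ≤ n := by
    intro n i j hi hj
    have h : ((n.sqrt : ℕ) : ℤ) ^ 2 ≤ n := by exact_mod_cast Nat.sqrt_le' n
    refine le_trans (sq_le_sq' ?_ ?_) h <;> omega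
  simp only [B, Finset.mem_product, Finset.mem_range] at hv hw
  simp only [f, Prod.mk.injEq, ZMod.intCast_eq_intCast_iff_dvd_sub] at hf
  refine ⟨(x' : ℤ) - x, (y' : ℤ) - y, (z' : ℤ) - z, ?_, ?_, ?_, ?_, ?_, ?_, ?_⟩
  · by_contra! h
    apply hvw
    simp only [Prod.mk.injEq]
    omega
  · exact_mod_cast bound hw.1 hv.1
  · exact_mod_cast bound hw.2.1 hv.2.1
  · exact_mod_cast bound hw.2.2 hv.2.2
  · convert hf.1 using 1; ring
  · convert hf.2.1 using 1; ring
  · convert hf.2.2 using 1; ring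

/-- Legendre's theorem on `a x² + b y² = c z²`, for pairwise coprime `a`, `b`, `c` such that `a b`
and `b c` are not squares. -/
theorem exists_mul_sq_add_mul_sq_eq_mul_sq {a b c : ℕ} (ha : 0 < a) (hb : 0 < b) (hc : 0 < c)
    (hab : a.Coprime b) (hac : a.Coprime c) (hbc : b.Coprime c)
    (hsab : ¬ IsSquare (a * b)) (hsbc : ¬ IsSquare (b * c)) {s t u : ℤ}
    (hs : (a : ℤ) ∣ b * c - s ^ 2) (ht : (b : ℤ) ∣ a * c - t ^ 2)
    (hu : (c : ℤ) ∣ a * b + u ^ 2) :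
    ∃ x y z : ℤ, x ≠ 0 ∧ z ≠ 0 ∧ a * x ^ 2 + b * y ^ 2 = c * z ^ 2 := by
  have ha' : (0 : ℤ) < a := by exact_mod_cast ha
  have hb' : (0 : ℤ) < b := by exact_mod_cast hb
  have hc' : (0 : ℤ) < c := by exact_mod_cast hc
  have sq_nat : ∀ {n : ℕ} {k : ℤ}, k ^ 2 = n → IsSquare n := fun {n k} h ↦
    ⟨k.natAbs, by zify; rw [← h, ← sq, sq_abs]⟩
  suffices H : ∃ x y z : ℤ, z ≠ 0 ∧ a * x ^ 2 + b * y ^ 2 = c * z ^ 2 by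
    obtain ⟨x, y, z, hz, h⟩ := H
    refine ⟨x, y, z, ?_, hz, h⟩
    rintro rfl
    apply hsbc
    have hy : y ≠ 0 := by
      rintro rfl
      have : (c : ℤ) * z ^ 2 = 0 := by linarith
      simp_all
    have : IsSquare (((b * c : ℕ) : ℚ)) := by
      refine ⟨c * z / y, ?_⟩
      have hy' : (y : ℚ) ≠ 0 := by exact_mod_cast hy
      have h' : (b : ℚ) * y ^ 2 = c * z ^ 2 := by
        have : (b : ℤ) * y ^ 2 = c * z ^ 2 := by linarith
        exact_mod_cast this
      field_simp
      push_cast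
      linear_combination (c : ℚ) * h'
    exact_mod_cast Rat.isSquare_natCast_iff.mp this
  obtain ⟨x, y, z, hne, hx, hy, hz, da, db, dc⟩ :=
    exists_small_solution_of_congruences ha hb hc s t u
  have Da : (a : ℤ) ∣ a * x ^ 2 + b * y ^ 2 - c * z ^ 2 := by
    refine IsCoprime.dvd_of_dvd_mul_left (y := (b : ℤ)) hab.isCoprime ?_
    have := ((da.mul_right (b * y + s * z)).sub (hs.mul_right (z ^ 2))).add
      (Dvd.intro (b * x ^ 2) (rfl : (a : ℤ) * _ = _))
    convert this using 1; ring
  have Db : (b : ℤ) ∣ a * x ^ 2 + b * y ^ 2 - c * z ^ 2 := by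
    refine IsCoprime.dvd_of_dvd_mul_left (y := (a : ℤ)) hab.symm.isCoprime ?_
    have := ((db.mul_right (a * x + t * z)).sub (ht.mul_right (z ^ 2))).add
      (Dvd.intro (a * y ^ 2) (rfl : (b : ℤ) * _ = _))
    convert this using 1; ring
  have Dc : (c : ℤ) ∣ a * x ^ 2 + b * y ^ 2 - c * z ^ 2 := by
    refine IsCoprime.dvd_of_dvd_mul_left (y := (a : ℤ)) hac.symm.isCoprime ?_
    have := ((dc.mul_right (a * x + u * y)).add (hu.mul_right (y ^ 2))).sub
      (Dvd.intro (a * z ^ 2) (rfl : (c : ℤ) * _ = _))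
    convert this using 1; ring
  have D : (a * b * c : ℤ) ∣ a * x ^ 2 + b * y ^ 2 - c * z ^ 2 :=
    IsCoprime.mul_dvd (IsCoprime.mul_left hac.isCoprime
      hbc.isCoprime)
      (IsCoprime.mul_dvd hab.isCoprime Da Db) Dc
  obtain ⟨e, he⟩ := D
  have hz' : z ^ 2 < a * b := lt_of_le_of_ne hz fun h ↦ hsab (sq_nat (k := z) (by simpa using h))
  have hx' : x ^ 2 < b * c := lt_of_le_of_ne hx fun h ↦ hsbc (sq_nat (k := x) (by simpa using h))
  have hP : (0 : ℤ) < a * b * c := by positivity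
  have h1 : -1 < e := by
    by_contra! h
    nlinarith [mul_le_mul_of_nonneg_left h hP.le, mul_lt_mul_of_pos_left hz' hc',
      mul_nonneg ha'.le (sq_nonneg x), mul_nonneg hb'.le (sq_nonneg y)]
  have h2 : e < 2 := by
    by_contra! h
    nlinarith [mul_le_mul_of_nonneg_left h hP.le, mul_lt_mul_of_pos_left hx' ha',
      mul_le_mul_of_nonneg_left hy hb'.le, mul_nonneg hc'.le (sq_nonneg z)]
  obtain rfl | rfl : e = 0 ∨ e = 1 := by omega
  · refine ⟨x, y, z, ?_, by linarith⟩
    rintro rfl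
    have h3 : (a : ℤ) * x ^ 2 + b * y ^ 2 = 0 := by linarith
    have h4 : (a : ℤ) * x ^ 2 = 0 := by
      nlinarith [mul_nonneg ha'.le (sq_nonneg x), mul_nonneg hb'.le (sq_nonneg y)]
    have h5 : (b : ℤ) * y ^ 2 = 0 := by linarith
    simp only [mul_eq_zero, ha'.ne', hb'.ne', false_or, sq_eq_zero_iff] at h4 h5
    simp [h4, h5] at hne
  · refine ⟨x * z - b * y, a * x + y * z, z ^ 2 + a * b, by positivity, ?_⟩
    linear_combination (a * b + z ^ 2 : ℤ) * he

theorem jacobiSym_eq_one_of_modEq_one {n l : ℕ} (hn : Odd n) (hl : l % 4 = 1)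
    (h : l ≡ 1 [MOD n]) : J(n | l) = 1 := by
  have hodd : Odd l := Nat.odd_iff.mpr (by omega)
  rw [jacobiSym.quadratic_reciprocity_one_mod_four' hn hl,
    jacobiSym.mod_left' (a₂ := 1) (by exact_mod_cast h), jacobiSym.one_left]

theorem jacobiSym_neg_eq_of_three_mod_four {q n : ℕ} (hq : q % 4 = 3) (hn : Odd n) :
    J(-q | n) = J(n | q) := by
  rw [jacobiSym.neg _ hn]
  have hn' := Nat.odd_iff.mp hn
  rcases (by omega : n % 4 = 1 ∨ n % 4 = 3) with h | h
  · rw [ZMod.χ₄_nat_one_mod_four h, one_mul,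
      jacobiSym.quadratic_reciprocity_one_mod_four h (Nat.odd_iff.mpr (by omega))]
  · rw [ZMod.χ₄_nat_three_mod_four h, jacobiSym.quadratic_reciprocity_three_mod_four hq h]
    ring

theorem exists_dvd_sub_sq_of_jacobiSym_eq_one {l : ℕ} (hl : l.Prime) {n : ℤ} (h : J(n | l) = 1) :
    ∃ u : ℤ, (l : ℤ) ∣ n - u ^ 2 := by
  have := Fact.mk hl
  obtain ⟨r, hr⟩ := ZMod.isSquare_of_jacobiSym_eq_one h
  obtain ⟨u, rfl⟩ := ZMod.intCast_surjective r
  refine ⟨u, ?_⟩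
  rw [← ZMod.intCast_zmod_eq_zero_iff_dvd]
  push_cast
  rw [hr]
  ring

theorem Nat.Prime.not_isSquare_mul {r k : ℕ} (hr : r.Prime) (h : r.Coprime k) :
    ¬ IsSquare (r * k) := by
  rintro ⟨n, hn⟩
  have h1 : r ∣ n := by
    have : r ∣ n * n := hn ▸ Dvd.intro _ rfl
    simpa using (hr.dvd_mul).mp this
  obtain ⟨j, rfl⟩ := h1
  have h2 : k = r * (j * j) := Nat.eq_of_mul_eq_mul_left hr.pos (by rw [hn]; ring)
  exact hr.one_lt.ne' (Nat.Coprime.eq_one_of_dvd h ⟨_, h2⟩)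

/-- A sufficient condition for `m` to be represented over `ℚ` by `x² + q y² - p z²`. -/
theorem exists_rat_ternary_eq {p q m n : ℕ} (hp : p.Prime) (hq : q.Prime) (hpq : p.Coprime q)
    (hq2 : Odd q) (hn : Odd n) (hnp : n.Coprime p) (hnq : n.Coprime q)
    (hm : m = n ∨ m = 2 * n ∧ Odd p) (hJ : J(p | n) = 1) {v : ℤ} (hv : (p : ℤ) ∣ m - v ^ 2) :
    ∃ x y z : ℚ, x ^ 2 + q * y ^ 2 - p * z ^ 2 = m := by
  have hmp : m.Coprime p := by
    rcases hm with rfl | ⟨rfl, hp2⟩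
    · exact hnp
    · exact Nat.Coprime.mul_left (Nat.coprime_two_left.mpr hp2) hnp
  have hn0 : n ≠ 0 := by rintro rfl; simp at hn
  have hm0 : 0 < m := by omega
  have hcop : (8 * p * q).Coprime n := by
    refine Nat.Coprime.mul_left (Nat.Coprime.mul_left ?_ hnp.symm) hnq.symm
    exact (Nat.coprime_two_left.mpr hn).pow_left 3
  obtain ⟨k, hk1, hk2⟩ := Nat.chineseRemainder hcop 1 p
  have hkc : k.Coprime (8 * p * q * n) := by
    refine Nat.Coprime.mul_right ?_ ?_
    · rw [Nat.coprime_iff_gcd_eq_one, hk1.gcd_eq, Nat.gcd_one_left]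
    · rw [Nat.coprime_iff_gcd_eq_one, hk2.gcd_eq]; exact hnp.symm
  obtain ⟨l, hlgt, hl, hlk⟩ := Nat.forall_exists_prime_gt_and_modEq (m + p + q)
    (mul_ne_zero (mul_ne_zero (mul_ne_zero (by norm_num) hp.ne_zero) hq.ne_zero) hn0) hkc
  have hl1 : l ≡ 1 [MOD 8 * p * q] := (hlk.of_mul_right n).trans hk1
  have hlp : l ≡ p [MOD n] := (hlk.of_mul_left (8 * p * q)).trans hk2
  have hl8 : l % 8 = 1 := (hl1.of_mul_right q).of_mul_right p
  have hl1p : l ≡ 1 [MOD p] := (hl1.of_mul_right q).of_mul_left 8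
  have hl1q : l ≡ 1 [MOD q] := hl1.of_mul_left (8 * p)
  have hlodd : Odd l := Nat.odd_iff.mpr (by omega)
  have hl4 : l % 4 = 1 := by omega
  have coprime_l : ∀ {r : ℕ}, 0 < r → r < l → r.Coprime l := fun h0 h ↦
    (Nat.coprime_of_lt_prime h0.ne' h hl).symm
  have hml := coprime_l hm0 (by omega)
  have hpl := coprime_l hp.pos (by omega)
  have hql := coprime_l hq.pos (by omega)
  have hneg (a : ℤ) : J(-a | l) = J(a | l) := by
    rw [jacobiSym.neg _ hlodd, ZMod.χ₄_nat_one_mod_four hl4, one_mul]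
  have hJ2 : J(2 | l) = 1 := by
    rw [jacobiSym.at_two hlodd, ZMod.χ₈_nat_eq_if_mod_eight]
    simp [hl8, (by omega : l % 2 = 1)]
  have hJq : J(-q | l) = 1 := by rw [hneg, jacobiSym_eq_one_of_modEq_one hq2 hl4 hl1q]
  have hJp : J(p | l) = 1 := by
    rcases hp.eq_two_or_odd' with rfl | hp2
    · exact_mod_cast hJ2
    · exact jacobiSym_eq_one_of_modEq_one hp2 hl4 hl1p
  have hJn : J(n | l) = 1 := by
    rw [jacobiSym.quadratic_reciprocity_one_mod_four' hn hl4,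
      jacobiSym.mod_left' (a₂ := p) (by exact_mod_cast hlp), hJ]
  have hJm : J(m | l) = 1 := by
    rcases hm with rfl | ⟨rfl, -⟩
    · exact hJn
    · push_cast
      rw [jacobiSym.mul_left, hJ2, hJn, one_mul]
  obtain ⟨u, hu⟩ := exists_dvd_sub_sq_of_jacobiSym_eq_one hl hJq
  obtain ⟨w, hw⟩ := exists_dvd_sub_sq_of_jacobiSym_eq_one hl (n := -(m * p))
    (by rw [hneg, jacobiSym.mul_left, hJm, hJp, one_mul])
  have dvd_q : (q : ℤ) ∣ l - 1 := (Nat.modEq_iff_dvd.mp hl1q.symm)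
  have dvd_p : (p : ℤ) ∣ l - 1 := (Nat.modEq_iff_dvd.mp hl1p.symm)
  have dvd_n : (n : ℤ) ∣ l - p := (Nat.modEq_iff_dvd.mp hlp.symm)
  have dvd_m : (m : ℤ) ∣ l - p := by
    rcases hm with rfl | ⟨rfl, hp2⟩
    · exact dvd_n
    · push_cast
      refine IsCoprime.mul_dvd ?_ ?_ dvd_n
      · exact_mod_cast (Nat.coprime_two_left.mpr hn).isCoprime
      · have := Nat.odd_iff.mp hp2
        omega
  obtain ⟨x₁, y₁, z₁, -, hz₁, h₁⟩ := exists_mul_sq_add_mul_sq_eq_mul_sq (a := 1) (b := q) (c := l)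
    one_pos hq.pos hl.pos (Nat.coprime_one_left _) (Nat.coprime_one_left _) hql
    (by simpa using hq.not_isSquare_mul (Nat.coprime_one_right q))
    (hq.not_isSquare_mul hql) (s := 0) (t := 1) (u := u)
    (by simp) (by simpa using dvd_q)
    (by obtain ⟨j, hj⟩ := hu; exact ⟨-j, by push_cast; linear_combination -hj⟩)
  obtain ⟨x₂, y₂, z₂, hx₂, hz₂, h₂⟩ := exists_mul_sq_add_mul_sq_eq_mul_sq (a := m) (b := p) (c := l)
    hm0 hp.pos hl.pos hmp hml hpl
    (by rw [mul_comm]; exact hp.not_isSquare_mul hmp.symm)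
    (hp.not_isSquare_mul hpl) (s := p) (t := v) (u := w)
    (by obtain ⟨j, hj⟩ := dvd_m; exact ⟨p * j, by linear_combination (p : ℤ) * hj⟩)
    (by
      obtain ⟨i, hi⟩ := dvd_p
      obtain ⟨j, hj⟩ := hv
      exact ⟨m * i + j, by linear_combination (m : ℤ) * hi + hj⟩)
    (by obtain ⟨j, hj⟩ := hw; exact ⟨-j, by linear_combination -hj⟩)
  have hz₁' : (z₁ : ℚ) ≠ 0 := by exact_mod_cast hz₁
  have hx₂' : (x₂ : ℚ) ≠ 0 := by exact_mod_cast hx₂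
  have e₁ : (x₁ : ℚ) ^ 2 + q * y₁ ^ 2 = l * z₁ ^ 2 := by exact_mod_cast (by simpa using h₁)
  have e₂ : (m : ℚ) * x₂ ^ 2 + p * y₂ ^ 2 = l * z₂ ^ 2 := by exact_mod_cast h₂
  refine ⟨z₂ / x₂ * (x₁ / z₁), z₂ / x₂ * (y₁ / z₁), y₂ / x₂, ?_⟩
  field_simp
  linear_combination (z₂ : ℚ) ^ 2 * e₁ - (z₁ : ℚ) ^ 2 * e₂

/-- Pairs of primes for which the quaternion algebra `(-q, p)` over `ℚ` is ramified exactly at `p`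
and `q`; see `AdmissiblePair.mem_robinsonSet_iff`. -/
structure AdmissiblePair (p q : ℕ) : Prop where
  prime_left : p.Prime
  prime_right : q.Prime
  cases : p = 2 ∧ q = 3 ∨ Odd p ∧ q % 8 = 7 ∧ J(-q | p) = -1

/-- Every prime `p` is part of an admissible pair. -/
theorem Nat.Prime.exists_admissiblePair {p : ℕ} (hp : p.Prime) : ∃ q, AdmissiblePair p q := by
  rcases hp.eq_two_or_odd' with rfl | hodd
  · exact ⟨3, hp, Nat.prime_three, .inl ⟨rfl, rfl⟩⟩
  have := Fact.mk hp
  have hchar : ringChar (ZMod p) ≠ 2 := by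
    rw [ZMod.ringChar_zmod_n]
    rintro rfl
    exact absurd hodd (by decide)
  obtain ⟨a, ha⟩ := FiniteField.exists_nonsquare hchar
  obtain ⟨k, hk1, hk2⟩ := Nat.chineseRemainder
    ((Nat.coprime_two_left.mpr hodd).pow_left 3 : (2 ^ 3).Coprime p) 7 (-a).val
  have hka : (k : ZMod p) = -a := by
    rw [(ZMod.natCast_eq_natCast_iff _ _ _).mpr hk2, ZMod.natCast_zmod_val]
  have hkc : k.Coprime (2 ^ 3 * p) := by
    refine Nat.Coprime.mul_right ?_ ?_
    · rw [Nat.coprime_iff_gcd_eq_one, hk1.gcd_eq]; norm_num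
    · rw [← ZMod.isUnit_iff_coprime, hka, isUnit_iff_ne_zero, neg_ne_zero]
      rintro rfl
      exact ha IsSquare.zero
  obtain ⟨q, -, hq, hqk⟩ := Nat.forall_exists_prime_gt_and_modEq 0
    (mul_ne_zero (by norm_num) hp.ne_zero) hkc
  refine ⟨q, hp, hq, .inr ⟨hodd, (hqk.of_mul_right p).trans hk1, ?_⟩⟩
  apply ZMod.nonsquare_iff_jacobiSym_eq_neg_one.mpr
  push_cast
  rwa [(ZMod.natCast_eq_natCast_iff _ _ _).mpr (hqk.of_mul_left (2 ^ 3)), hka, neg_neg]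

namespace AdmissiblePair

variable {p q : ℕ}

theorem three_mod_four (h : AdmissiblePair p q) : q % 4 = 3 := by
  rcases h.cases with ⟨-, rfl⟩ | ⟨-, h, -⟩ <;> omega

theorem jacobiSym_eq_neg_one (h : AdmissiblePair p q) : J(p | q) = -1 := by
  rcases h.cases with ⟨rfl, rfl⟩ | ⟨hp, -, hJ⟩
  · norm_num
  · rwa [jacobiSym_neg_eq_of_three_mod_four h.three_mod_four hp] at hJ

theorem coprime (h : AdmissiblePair p q) : p.Coprime q := by
  refine (Nat.coprime_primes h.prime_left h.prime_right).mpr ?_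
  rintro rfl
  rcases h.cases with ⟨h1, h2⟩ | ⟨-, -, hJ⟩
  · omega
  · have := h.jacobiSym_eq_neg_one
    rw [jacobiSym.mod_left] at this
    simp [jacobiSym.zero_left h.prime_left.one_lt] at this

theorem exists_ternary_eq (h : AdmissiblePair p q) {A B : ℕ} (hAB : A.Coprime B)
    (hBp : B.Coprime p) (hBq : B.Coprime q) :
    ∃ x y z : ℚ, x ^ 2 + q * y ^ 2 - p * z ^ 2 = B ^ 2 + p * q * A ^ 2 := by
  have hq2 : Odd q := Nat.odd_iff.mpr (by have := h.three_mod_four; omega)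
  obtain ⟨m, s, hM, hsq⟩ := Nat.sq_mul_squarefree (B ^ 2 + p * q * A ^ 2)
  have hMp : (s ^ 2 * m).Coprime p := by
    rw [hM, mul_assoc, Nat.coprime_add_mul_left_left]
    exact hBp.pow_left 2
  have hMq : (s ^ 2 * m).Coprime q := by
    rw [hM, mul_right_comm, Nat.coprime_add_mul_right_left]
    exact hBq.pow_left 2
  have hMA : (s ^ 2 * m).Coprime A := by
    rw [hM, sq A, ← mul_assoc, Nat.coprime_add_mul_right_left]
    exact hAB.symm.pow_left 2
  have hMB : (s ^ 2 * m).Coprime B := by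
    rw [hM, sq B, add_comm, Nat.coprime_add_mul_right_left]
    exact Nat.Coprime.mul_left (Nat.Coprime.mul_left hBp.symm hBq.symm) (hAB.pow_left 2)
  have hM' : (s : ℤ) ^ 2 * m = B ^ 2 + p * q * A ^ 2 := by exact_mod_cast hM
  have hmq : J(m | q) = 1 := by
    have hsq : (s : ℤ).gcd q = 1 := by
      simpa using (hMq.coprime_mul_right).coprime_dvd_left (Dvd.intro_left _ (pow_succ s 1).symm)
    have h1 : J((s : ℤ) ^ 2 * m | q) = J((B : ℤ) ^ 2 | q) := by
      apply jacobiSym.mod_left'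
      rw [hM', mul_right_comm]
      simp [Int.add_emod, mul_comm _ (q : ℤ)]
    rwa [jacobiSym.mul_left, jacobiSym.sq_one' hsq, one_mul,
      jacobiSym.sq_one' (by simpa using hBq)] at h1
  obtain ⟨v, hv⟩ : ∃ v : ℤ, (p : ℤ) ∣ m - v ^ 2 := by
    have : s.Coprime p :=
      (hMp.coprime_mul_right).coprime_dvd_left (Dvd.intro_left _ (pow_succ s 1).symm)
    obtain ⟨u, w, huw⟩ := this.isCoprime
    exact ⟨B * u, m * (2 * w - w ^ 2 * p) + q * A ^ 2 * u ^ 2, by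
      linear_combination (u ^ 2 : ℤ) * hM' - (m * (1 - w * p + u * s) : ℤ) * huw⟩
  obtain ⟨n, hn, hm⟩ : ∃ n, Odd n ∧ (m = n ∨ m = 2 * n) := by
    rcases Nat.even_or_odd' m with ⟨n, rfl | rfl⟩
    · refine ⟨n, ?_, .inr rfl⟩
      by_contra hn
      rw [Nat.not_odd_iff_even] at hn
      obtain ⟨j, rfl⟩ := hn
      have := hsq 2 ⟨j, by ring⟩
      simp at this
    · exact ⟨_, odd_two_mul_add_one n, .inl rfl⟩
  have hnm : n ∣ m := by rcases hm with rfl | rfl <;> simp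
  have hnM : n ∣ s ^ 2 * m := hnm.mul_left _
  have hp2 : m = 2 * n → Odd p := by
    rintro rfl
    exact Nat.coprime_two_left.mp (hMp.coprime_dvd_left (((dvd_mul_right 2 n)).mul_left _))
  have hJ : J(p | n) = 1 := by
    rcases h.cases with ⟨rfl, rfl⟩ | ⟨hp, hq8, -⟩
    · obtain rfl : m = n := hm.resolve_right fun h' ↦ absurd (hp2 h') (by decide)
      have hBo : Odd B := Nat.coprime_two_right.mp hBp
      have hso : Odd s := by
        have := Nat.coprime_two_right.mp hMp
        rw [Nat.odd_mul] at this
        exact (Nat.odd_pow_iff two_ne_zero).mp this.1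
      have h8 : ∀ {i : ℕ}, Odd i → i ^ 2 % 8 = 1 := fun {i} hi ↦ by
        have := Nat.odd_iff.mp hi
        rw [Nat.pow_mod]
        rcases (by omega : i % 8 = 1 ∨ i % 8 = 3 ∨ i % 8 = 5 ∨ i % 8 = 7) with h | h | h | h <;>
          rw [h]
      have e1 := h8 hBo
      have e2 := h8 hso
      have e3 : m % 8 = (B ^ 2 + 2 * 3 * A ^ 2) % 8 := by rw [← hM, Nat.mul_mod, e2]; simp
      have e4 : A ^ 2 % 4 = 0 ∨ A ^ 2 % 4 = 1 := by
        rcases Nat.even_or_odd' A with ⟨j, rfl | rfl⟩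
        · left; ring_nf; omega
        · right; ring_nf; omega
      have e5 : m % 8 = 1 ∨ m % 8 = 7 := by omega
      push_cast
      rw [jacobiSym.at_two hn, ZMod.χ₈_nat_eq_if_mod_eight]
      simp [e5, Nat.odd_iff.mp hn]
    · have h2q : J(2 | q) = 1 := by
        rw [jacobiSym.at_two hq2, ZMod.χ₈_nat_eq_if_mod_eight]
        simp [hq8, (by omega : q % 2 = 1)]
      have hnq : J(n | q) = 1 := by
        rcases hm with rfl | rfl
        · exact hmq
        · push_cast at hmq
          rwa [jacobiSym.mul_left, h2q, one_mul] at hmq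
      have h1 : J(-(p * q * (A : ℤ) ^ 2) | n) = J((B : ℤ) ^ 2 | n) := by
        apply jacobiSym.mod_left'
        refine Int.modEq_iff_dvd.mpr ?_
        obtain ⟨j, hj⟩ := Int.natCast_dvd_natCast.mpr hnM
        exact ⟨j, by rw [← hj]; push_cast; linear_combination -hM'⟩
      rw [jacobiSym.sq_one' (by simpa using (hMB.coprime_dvd_left hnM).symm),
        show -(p * q * (A : ℤ) ^ 2) = p * (-q * (A : ℤ) ^ 2) by ring, jacobiSym.mul_left,
        jacobiSym.mul_left,
        jacobiSym_neg_eq_of_three_mod_four h.three_mod_four hn, hnq,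
        jacobiSym.sq_one' (by simpa using (hMA.coprime_dvd_left hnM).symm)] at h1
      simpa using h1
  obtain ⟨x, y, z, hxyz⟩ := exists_rat_ternary_eq h.prime_left h.prime_right h.coprime hq2 hn
    (hMp.coprime_dvd_left hnM) (hMq.coprime_dvd_left hnM)
    (hm.imp_right fun h' ↦ ⟨h', hp2 h'⟩) hJ hv
  refine ⟨s * x, s * y, s * z, ?_⟩
  have hM'' : (s : ℚ) ^ 2 * m = B ^ 2 + p * q * A ^ 2 := by exact_mod_cast hM
  linear_combination (s : ℚ) ^ 2 * hxyz + hM''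

end AdmissiblePair

theorem Nat.Prime.dvd_of_sq_dvd_quaternary {r : ℕ} (hr : r.Prime) {a e : ℤ} (ha : J(a | r) = -1)
    (he : IsUnit e) {x y z w : ℤ}
    (h : (r : ℤ) ^ 2 ∣ x ^ 2 - a * y ^ 2 + r * e * (z ^ 2 - a * w ^ 2)) :
    ((r : ℤ) ∣ x ∧ (r : ℤ) ∣ y) ∧ (r : ℤ) ∣ z ∧ (r : ℤ) ∣ w := by
  have := Fact.mk hr
  have hr0 : (r : ℤ) ≠ 0 := by exact_mod_cast hr.ne_zero
  have hxy : (r : ℤ) ∣ x ∧ (r : ℤ) ∣ y := by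
    refine jacobiSym.prime_dvd_of_eq_neg_one ha ?_
    obtain ⟨j, hj⟩ := h
    exact ⟨r * j - e * (z ^ 2 - a * w ^ 2), by linear_combination hj⟩
  refine ⟨hxy, jacobiSym.prime_dvd_of_eq_neg_one ha ?_⟩
  obtain ⟨⟨i, rfl⟩, j, rfl⟩ := hxy
  obtain ⟨k, hk⟩ := h
  rw [← he.dvd_mul_left]
  refine ⟨k - i ^ 2 + a * j ^ 2, mul_left_cancel₀ hr0 ?_⟩
  linear_combination hk

theorem Int.two_dvd_of_sixteen_dvd_quaternary {x y z w : ℤ}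
    (h : 16 ∣ x ^ 2 + 3 * y ^ 2 - 2 * z ^ 2 - 6 * w ^ 2) :
    (2 ∣ x ∧ 2 ∣ y) ∧ 2 ∣ z ∧ 2 ∣ w := by
  have key : ∀ i : ℤ, (2 ∣ i ∧ (i ^ 2 % 16 = 0 ∨ i ^ 2 % 16 = 4)) ∨
      (¬ 2 ∣ i ∧ (i ^ 2 % 16 = 1 ∨ i ^ 2 % 16 = 9)) := by
    intro i
    have h1 : i ^ 2 % 16 = (i % 16) ^ 2 % 16 := by simp [pow_two, Int.mul_emod]
    have h2 : 2 ∣ i ↔ 2 ∣ i % 16 := by omega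
    rw [h1, h2]
    have h3 : 0 ≤ i % 16 := Int.emod_nonneg _ (by norm_num)
    have h4 : i % 16 < 16 := Int.emod_lt_of_pos _ (by norm_num)
    generalize i % 16 = j at h3 h4
    interval_cases j <;> decide
  have hx := key x
  have hy := key y
  have hz := key z
  have hw := key w
  omega

/-- Infinite descent: a form that is anisotropic at `r` forces `r`-integrality. -/
theorem not_dvd_den_of_anisotropic {p q r : ℕ} (hr : r.Prime)
    (H : ∀ x y z w : ℤ, (r : ℤ) ^ 4 ∣ x ^ 2 + q * y ^ 2 - p * z ^ 2 - p * q * w ^ 2 →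
      ((r : ℤ) ∣ x ∧ (r : ℤ) ∣ y) ∧ (r : ℤ) ∣ z ∧ (r : ℤ) ∣ w)
    {x y z k : ℚ} (h : x ^ 2 + q * y ^ 2 = 1 + p * q * k ^ 4 + p * z ^ 2) : ¬ r ∣ k.den := by
  intro hk
  have hr0 : (r : ℤ) ≠ 0 := by exact_mod_cast hr.ne_zero
  have hcop : IsCoprime ((r : ℤ) ^ 2) (k.num ^ 2) := by
    refine IsCoprime.pow ?_
    rw [Int.isCoprime_iff_gcd_eq_one, Int.gcd_comm]
    exact k.reduced.coprime_dvd_right hk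
  have descent : ∀ n : ℕ, ∀ X Y Z W V : ℤ, V.natAbs = n → V ≠ 0 →
      X ^ 2 + q * Y ^ 2 - p * Z ^ 2 - p * q * W ^ 2 = V ^ 2 →
      W * k.den ^ 2 = k.num ^ 2 * V → False := by
    intro n
    induction n using Nat.strong_induction_on with
    | _ n ih =>
      intro X Y Z W V hn hV hf hW
      have hV2 : (r : ℤ) ^ 2 ∣ V := by
        refine hcop.dvd_of_dvd_mul_left ?_
        rw [← hW]
        exact (pow_dvd_pow_of_dvd (Int.natCast_dvd_natCast.mpr hk) 2).mul_left _
      obtain ⟨⟨⟨X, rfl⟩, Y, rfl⟩, ⟨Z, rfl⟩, W, rfl⟩ := H X Y Z W (by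
        rw [hf]
        simpa only [← pow_mul] using pow_dvd_pow_of_dvd hV2 2)
      obtain ⟨V, rfl⟩ : (r : ℤ) ∣ V := (Dvd.intro_left _ (pow_succ _ 1).symm).trans hV2
      have hV' : V ≠ 0 := right_ne_zero_of_mul hV
      refine ih V.natAbs ?_ X Y Z W V rfl hV' ?_ ?_
      · rw [← hn, Int.natAbs_mul, Int.natAbs_natCast]
        exact lt_mul_left (Int.natAbs_pos.mpr hV') hr.one_lt
      · apply mul_left_cancel₀ (pow_ne_zero 2 hr0)
        linear_combination hf
      · apply mul_left_cancel₀ hr0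
        linear_combination hW
  have ex := x.num_div_den
  have ey := y.num_div_den
  have ez := z.num_div_den
  have ek := k.num_div_den
  have hxd : (x.den : ℚ) ≠ 0 := by exact_mod_cast x.den_ne_zero
  have hyd : (y.den : ℚ) ≠ 0 := by exact_mod_cast y.den_ne_zero
  have hzd : (z.den : ℚ) ≠ 0 := by exact_mod_cast z.den_ne_zero
  have hkd : (k.den : ℚ) ≠ 0 := by exact_mod_cast k.den_ne_zero
  refine descent _ (x.num * (y.den * z.den * k.den ^ 2)) (y.num * (x.den * z.den * k.den ^ 2))
    (z.num * (x.den * y.den * k.den ^ 2)) (k.num ^ 2 * (x.den * y.den * z.den))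
    (x.den * y.den * z.den * k.den ^ 2) rfl (by simp) ?_ (by ring)
  rw [← ex, ← ey, ← ez, ← ek] at h
  have : ((x.num * (y.den * z.den * k.den ^ 2) : ℚ)) ^ 2 +
      q * (y.num * (x.den * z.den * k.den ^ 2)) ^ 2 -
      p * (z.num * (x.den * y.den * k.den ^ 2)) ^ 2 -
      p * q * (k.num ^ 2 * (x.den * y.den * z.den)) ^ 2 =
      (x.den * y.den * z.den * k.den ^ 2) ^ 2 := by
    field_simp at h
    linear_combination h
  exact_mod_cast this

/-- Robinson's family of existentially definable sets of rationals. -/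
def robinsonSet (p q : ℚ) : Set ℚ :=
  {k | ∃ x y z : ℚ, x ^ 2 + q * y ^ 2 = 1 + p * q * k ^ 4 + p * z ^ 2}

theorem zero_mem_robinsonSet (p q : ℚ) : 0 ∈ robinsonSet p q :=
  ⟨1, 0, 0, by ring⟩

namespace AdmissiblePair

variable {p q : ℕ}

/-- For an admissible pair `p`, `q`, the set `robinsonSet p q` consists of the rationals that are
integral at `p` and at `q`. -/
theorem mem_robinsonSet_iff (h : AdmissiblePair p q) {k : ℚ} :
    k ∈ robinsonSet p q ↔ ¬ p ∣ k.den ∧ ¬ q ∣ k.den := by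
  constructor
  · rintro ⟨x, y, z, hxyz⟩
    refine ⟨not_dvd_den_of_anisotropic h.prime_left (fun x y z w hd ↦ ?_) hxyz,
      not_dvd_den_of_anisotropic h.prime_right (fun x y z w hd ↦ ?_) hxyz⟩
    · rcases h.cases with ⟨rfl, rfl⟩ | ⟨-, -, hJ⟩
      · exact Int.two_dvd_of_sixteen_dvd_quaternary (by norm_num at hd; exact hd)
      · refine h.prime_left.dvd_of_sq_dvd_quaternary hJ (e := -1) (by simp) ?_
        obtain ⟨j, hj⟩ := (pow_dvd_pow (p : ℤ) (by norm_num : 2 ≤ 4)).trans hd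
        exact ⟨j, by linear_combination hj⟩
    · obtain ⟨⟨h1, h2⟩, h3, h4⟩ :=
        h.prime_right.dvd_of_sq_dvd_quaternary (x := x) (y := z) (z := y) (w := w)
          h.jacobiSym_eq_neg_one (e := 1) (by simp) (by
            obtain ⟨j, hj⟩ := (pow_dvd_pow (q : ℤ) (by norm_num : 2 ≤ 4)).trans hd
            exact ⟨j, by linear_combination hj⟩)
      exact ⟨⟨h1, h3⟩, h2, h4⟩
  · rintro ⟨hp, hq⟩
    have hp' := ((h.prime_left.coprime_iff_not_dvd).mpr hp).symm
    have hq' := ((h.prime_right.coprime_iff_not_dvd).mpr hq).symm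
    obtain ⟨x, y, z, hxyz⟩ := h.exists_ternary_eq (k.reduced.pow 2 2)
      (hp'.pow_left 2) (hq'.pow_left 2)
    have hkd : (k.den : ℚ) ≠ 0 := by exact_mod_cast k.den_ne_zero
    have hn : ((k.num.natAbs : ℚ)) ^ 2 = k.num ^ 2 := by
      rw [Nat.cast_natAbs, Int.cast_abs, sq_abs]
    push_cast at hxyz
    rw [hn] at hxyz
    refine ⟨x / k.den ^ 2, y / k.den ^ 2, z / k.den ^ 2, ?_⟩
    have ek : k ^ 4 = (k.num / k.den) ^ 4 := by rw [k.num_div_den]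
    rw [ek]
    field_simp
    linear_combination hxyz

theorem add_one_mem_robinsonSet (h : AdmissiblePair p q) {k : ℚ} (hk : k ∈ robinsonSet p q) :
    k + 1 ∈ robinsonSet p q := by
  have hden : (k + 1).den = k.den := by exact_mod_cast k.add_natCast_den 1
  rw [h.mem_robinsonSet_iff] at hk ⊢
  rwa [hden]

end AdmissiblePair

theorem range_natCast_eq :
    Set.range ((↑) : ℕ → ℚ) = {n : ℚ | (∃ a b c d : ℚ, n = a ^ 2 + b ^ 2 + c ^ 2 + d ^ 2) ∧
      ∀ p q : ℚ, (∀ k ∈ robinsonSet p q, k + 1 ∈ robinsonSet p q) → n ∈ robinsonSet p q} := by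
  ext n
  constructor
  · rintro ⟨n, rfl⟩
    refine ⟨?_, fun p q h ↦ ?_⟩
    · obtain ⟨a, b, c, d, h⟩ := Nat.sum_four_squares n
      exact ⟨a, b, c, d, by exact_mod_cast h.symm⟩
    · induction n with
      | zero => exact_mod_cast zero_mem_robinsonSet p q
      | succ n ih => exact_mod_cast h _ ih
  · rintro ⟨⟨a, b, c, d, hn⟩, H⟩
    have hnn : 0 ≤ n := by rw [hn]; positivity
    have hden : n.den = 1 := by
      by_contra hne
      obtain ⟨p, hp, hpn⟩ := Nat.exists_prime_and_dvd hne
      obtain ⟨q, h⟩ := hp.exists_admissiblePair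
      exact (h.mem_robinsonSet_iff.mp (H p q fun k hk ↦ h.add_one_mem_robinsonSet hk)).1 hpn
    refine ⟨n.num.toNat, ?_⟩
    have : ((n.num.toNat : ℤ) : ℚ) = n.num := by rw [Int.toNat_of_nonneg (Rat.num_nonneg.mpr hnn)]
    rw [← Int.cast_natCast, this]
    exact Rat.coe_int_num_of_den_eq_one hden

/-- The formula defining `robinsonSet p q`, with the first `n` bound variables already in use. -/
def robinsonFormula {α : Type*} {n : ℕ} (p q k : Language.ring.Term (α ⊕ Fin (n + 3))) :
    Language.ring.BoundedFormula α n :=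
  let x : Language.ring.Term (α ⊕ Fin (n + 3)) := Term.var (.inr ⟨n, by omega⟩)
  let y : Language.ring.Term (α ⊕ Fin (n + 3)) := Term.var (.inr ⟨n + 1, by omega⟩)
  let z : Language.ring.Term (α ⊕ Fin (n + 3)) := Term.var (.inr ⟨n + 2, by omega⟩)
  ((x * x + q * (y * y)).bdEqual (1 + p * q * (k * k * (k * k)) + p * (z * z))).ex.ex.ex

theorem realize_robinsonFormula {α : Type*} {n : ℕ}
    (p q k : Language.ring.Term (α ⊕ Fin (n + 3))) (v : α → ℚ) (w : Fin n → ℚ) {p' q' k' : ℚ}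
    (hp : ∀ x y z : ℚ, p.realize (Sum.elim v (Fin.snoc (Fin.snoc (Fin.snoc w x) y) z)) = p')
    (hq : ∀ x y z : ℚ, q.realize (Sum.elim v (Fin.snoc (Fin.snoc (Fin.snoc w x) y) z)) = q')
    (hk : ∀ x y z : ℚ, k.realize (Sum.elim v (Fin.snoc (Fin.snoc (Fin.snoc w x) y) z)) = k') :
    (robinsonFormula p q k).Realize v w ↔ k' ∈ robinsonSet p' q' := by
  simp only [robinsonFormula, BoundedFormula.realize_ex, BoundedFormula.realize_bdEqual,
    Ring.realize_add, Ring.realize_mul, Ring.realize_one, hp, hq, hk, Term.realize_var,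
    Sum.elim_inr, robinsonSet, Set.mem_ofPred_eq]
  simp [Fin.snoc, pow_succ, mul_assoc]

/-- Julia Robinson's theorem: the set of natural numbers inside the rationals is
definable without parameters in the language of rings over `ℚ`. -/
theorem stmt_9 :
    Set.Definable₁ (∅ : Set ℚ) Language.ring (Set.range ((↑) : ℕ → ℚ)) := by
  rw [Set.Definable₁, Set.empty_definable_iff]
  let n (m : ℕ) : Language.ring.Term (Fin 1 ⊕ Fin m) := Term.var (.inl 0)
  let b {m : ℕ} (i : Fin m) : Language.ring.Term (Fin 1 ⊕ Fin m) := Term.var (.inr i)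
  let nonneg : Language.ring.Formula (Fin 1) :=
    ((n 4).bdEqual (b 0 * b 0 + b 1 * b 1 + b 2 * b 2 + b 3 * b 3)).ex.ex.ex.ex
  let inductive_imp : Language.ring.Formula (Fin 1) :=
    (((robinsonFormula (b 0) (b 1) (b 2)).imp
      (robinsonFormula (b 0) (b 1) (b 2 + 1))).all.imp
        (robinsonFormula (b 0) (b 1) (n 5))).all.all
  refine ⟨nonneg ⊓ inductive_imp, ?_⟩
  ext v
  have h₁ : nonneg.Realize v ↔ ∃ x y z w : ℚ, v 0 = x ^ 2 + y ^ 2 + z ^ 2 + w ^ 2 := by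
    simp [nonneg, n, b, Formula.Realize, Fin.snoc, pow_two]
  have h₂ : inductive_imp.Realize v ↔ ∀ p q : ℚ,
      (∀ k ∈ robinsonSet p q, k + 1 ∈ robinsonSet p q) → v 0 ∈ robinsonSet p q := by
    simp only [inductive_imp, Formula.Realize, BoundedFormula.realize_all,
      BoundedFormula.realize_imp]
    refine forall₂_congr fun p q ↦ imp_congr (forall_congr' fun k ↦ imp_congr ?_ ?_) ?_ <;>
      refine realize_robinsonFormula _ _ _ _ _ ?_ ?_ ?_ <;>
      intros <;> simp [n, b, Fin.snoc]
  change v 0 ∈ Set.range ((↑) : ℕ → ℚ) ↔ (nonneg ⊓ inductive_imp).Realize v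
  rw [Formula.realize_inf, h₁, h₂, range_natCast_eq]
  rfl
end
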